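/- For a = −4/25, set J₁ = (2/25)·(3 − √5) and J₂ = (2/25)·(3 + √5). Then (J₁, 0) and (J₂, π/5) are saddle critical points of h̄(J,φ) = aJ + J² + J^{5/2}·cos(5φ) (critical points at which the Hessian determinant is negative), and they lie on the same level set: h̄(J₁, 0) = h̄(J₂, π/5) = −16/3125. -/

import Mathlib

/-- The rescaled `n = 5` model Hamiltonian `h̄(J,φ) = aJ + J² + J^(5/2)·cos(5φ)`
(real power). -/
noncomputable def hbar5 (a J φ : ℝ) : ℝ :=
  a * J + J ^ 2 + J ^ ((5 : ℝ) / 2) * Real.cos (5 * φ)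

theorem deriv_hbar5_action (a φ : ℝ) :
    deriv (fun J => hbar5 a J φ) =
      fun J => a + 2 * J + 5 / 2 * J ^ ((3 : ℝ) / 2) * Real.cos (5 * φ) := by
  funext J
  have h := (((hasDerivAt_id J).const_mul a).add ((hasDerivAt_id J).pow 2)).add
    ((Real.hasDerivAt_rpow_const (x := J) (p := (5 : ℝ) / 2)
      (Or.inr (by norm_num))).mul_const (Real.cos (5 * φ)))
  refine (h.congr_deriv ?_).deriv
  norm_num

theorem deriv_deriv_hbar5_action (a φ J : ℝ) :
    deriv (deriv (fun J => hbar5 a J φ)) J =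
      2 + 15 / 4 * J ^ ((1 : ℝ) / 2) * Real.cos (5 * φ) := by
  rw [deriv_hbar5_action]
  have h := (((hasDerivAt_id J).const_mul 2).const_add a).add
    (((Real.hasDerivAt_rpow_const (x := J) (p := (3 : ℝ) / 2)
      (Or.inr (by norm_num))).const_mul (5 / 2)).mul_const (Real.cos (5 * φ)))
  refine (h.congr_deriv ?_).deriv
  rw [show (3 : ℝ) / 2 - 1 = 1 / 2 by norm_num]
  ring

theorem deriv_hbar5_angle (a J : ℝ) :
    deriv (fun φ => hbar5 a J φ) =
      fun φ => -5 * J ^ ((5 : ℝ) / 2) * Real.sin (5 * φ) := by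
  funext φ
  have h := ((((hasDerivAt_id φ).const_mul 5).cos).const_mul
    (J ^ ((5 : ℝ) / 2))).const_add (a * J + J ^ 2)
  refine (h.congr_deriv ?_).deriv
  simp only [id]
  ring

theorem deriv_deriv_hbar5_angle (a J φ : ℝ) :
    deriv (deriv (fun φ => hbar5 a J φ)) φ =
      -25 * J ^ ((5 : ℝ) / 2) * Real.cos (5 * φ) := by
  rw [deriv_hbar5_angle]
  have h := (((hasDerivAt_id φ).const_mul 5).sin).const_mul (-5 * J ^ ((5 : ℝ) / 2))
  refine (h.congr_deriv ?_).deriv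
  simp only [id]
  ring

theorem sq_rpow_natCast_div_two {s : ℝ} (hs : 0 ≤ s) (n : ℕ) :
    (s ^ 2) ^ ((n : ℝ) / 2) = s ^ n := by
  rw [← Real.rpow_natCast s 2, ← Real.rpow_mul hs, ← Real.rpow_natCast s n]
  congr 1
  push_cast
  ring

/-- For `a = −4/25`, the points `(J₁,0)` and `(J₂,π/5)` with
`J₁ = (2/25)(3 − √5)`, `J₂ = (2/25)(3 + √5)` are saddle critical points of `h̄`
(critical points with negative Hessian determinant) and lie on the same level
set: `h̄(J₁,0) = h̄(J₂,π/5) = −16/3125`. -/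
theorem stmt_12 (a J₁ J₂ : ℝ) (ha : a = -4 / 25)
    (hJ₁ : J₁ = (2 / 25) * (3 - Real.sqrt 5))
    (hJ₂ : J₂ = (2 / 25) * (3 + Real.sqrt 5)) :
    (deriv (fun J => hbar5 a J 0) J₁ = 0 ∧
      deriv (fun φ => hbar5 a J₁ φ) 0 = 0 ∧
      deriv (deriv (fun J => hbar5 a J 0)) J₁ *
          deriv (deriv (fun φ => hbar5 a J₁ φ)) 0 -
        (deriv (fun J => deriv (fun φ => hbar5 a J φ) 0) J₁) ^ 2 < 0) ∧
    (deriv (fun J => hbar5 a J (Real.pi / 5)) J₂ = 0 ∧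
      deriv (fun φ => hbar5 a J₂ φ) (Real.pi / 5) = 0 ∧
      deriv (deriv (fun J => hbar5 a J (Real.pi / 5))) J₂ *
          deriv (deriv (fun φ => hbar5 a J₂ φ)) (Real.pi / 5) -
        (deriv (fun J => deriv (fun φ => hbar5 a J φ) (Real.pi / 5)) J₂) ^ 2 < 0) ∧
    hbar5 a J₁ 0 = -16 / 3125 ∧ hbar5 a J₂ (Real.pi / 5) = -16 / 3125 := by
  have h5 : Real.sqrt 5 ^ 2 = 5 := Real.sq_sqrt (by norm_num)
  have hlow : 2 < Real.sqrt 5 := by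
    rw [Real.lt_sqrt (by norm_num)]
    norm_num
  set r := Real.sqrt 5
  obtain ⟨s, hs⟩ : ∃ s, s = (r - 1) / 5 := ⟨_, rfl⟩
  obtain ⟨t, ht⟩ : ∃ t, t = (r + 1) / 5 := ⟨_, rfl⟩
  have hs0 : 0 < s := by rw [hs]; linarith
  have ht0 : 0 < t := by rw [ht]; linarith
  have hs2 : s ^ 2 = 4 / 25 - 2 / 5 * s := by rw [hs]; linear_combination h5 / 25
  have ht2 : t ^ 2 = 4 / 25 + 2 / 5 * t := by rw [ht]; linear_combination h5 / 25
  have hJs : J₁ = s ^ 2 := by rw [hJ₁, hs2, hs]; ring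
  have hJt : J₂ = t ^ 2 := by rw [hJ₂, ht2, ht]; ring
  have hcos : Real.cos (5 * (Real.pi / 5)) = -1 := by
    rw [mul_div_cancel₀ _ (by norm_num), Real.cos_pi]
  have hsin : Real.sin (5 * (Real.pi / 5)) = 0 := by
    rw [mul_div_cancel₀ _ (by norm_num), Real.sin_pi]
  have hs1r := sq_rpow_natCast_div_two hs0.le 1
  have hs3r := sq_rpow_natCast_div_two hs0.le 3
  have hs5r := sq_rpow_natCast_div_two hs0.le 5
  have ht1r := sq_rpow_natCast_div_two ht0.le 1
  have ht3r := sq_rpow_natCast_div_two ht0.le 3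
  have ht5r := sq_rpow_natCast_div_two ht0.le 5
  push_cast at hs1r hs3r hs5r ht1r ht3r ht5r
  have hs3 : s ^ 3 = 8 / 25 * s - 8 / 125 := by linear_combination (s - 2 / 5) * hs2
  have ht3 : t ^ 3 = 8 / 25 * t + 8 / 125 := by linear_combination (t + 2 / 5) * ht2
  have hs5 : 0 < s ^ 5 := by positivity
  have ht5 : 0 < t ^ 5 := by positivity
  simp only [deriv_deriv_hbar5_action, deriv_deriv_hbar5_angle]
  simp only [deriv_hbar5_action, deriv_hbar5_angle]
  simp only [hcos, hsin, hJs, hJt, ha, hbar5,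
    mul_zero, Real.cos_zero, Real.sin_zero, deriv_const, hs1r, hs3r, hs5r, ht1r, ht3r, ht5r]
  refine ⟨⟨?_, trivial, ?_⟩, ⟨?_, trivial, ?_⟩, ?_, ?_⟩
  · linear_combination 2 * hs2 + 5 / 2 * hs3
  · have := mul_pos hs0 hs5
    linarith
  · linear_combination 2 * ht2 - 5 / 2 * ht3
  · have hneg : 2 - 15 / 4 * t < 0 := by rw [ht]; linarith
    have := mul_neg_of_neg_of_pos hneg ht5
    linarith
  · linear_combination (-4 / 25) * hs2 + s * hs3 + s ^ 2 * hs3 +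
      (8 / 25 + 8 / 25 * s - 24 / 125) * hs2
  · linear_combination (-4 / 25) * ht2 + t * ht3 - t ^ 2 * ht3 +
      (8 / 25 - 8 / 25 * t - 24 / 125) * ht2
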